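/- arXiv:2501.09871 — 3 statements merged into one kernel-verified Lean document; each statement's English description precedes it below -/
import Mathlib

section
/- Let d ≥ 2, α ∈ (1,2], β ∈ (1,d], and let p, r satisfy hypothesis (H2): either max{2d/(d+β−1), d/(α+β−2)} < p ≤ d/(β−1) and max{p, p/(p−1), d/(α−1)} < r < pd/(d−p(β−1)), or p > d/(β−1) and r > max{p, p/(p−1), d/(α−1)}; and assume p < dα/(2β(α−1)−α) whenever 2β(α−1) − α ≥ 0. Set σ = 2 − (1/α)(d/r + 1) − (d/β)(1/p − 1/r) − 1/β and p₂ = drα/(β(r(α−1) − d) + dα). Then 1 < p₂ < r and σ + (d/β)(1/p₂ − 1/r) < 1. -/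
/-- Hypothesis (H2) on the exponents `p, r`. -/
def H2strict (d α β p r : ℝ) : Prop :=
  (max (2 * d / (d + β - 1)) (d / (α + β - 2)) < p ∧ p ≤ d / (β - 1) ∧
    max (max p (p / (p - 1))) (d / (α - 1)) < r ∧ r < p * d / (d - p * (β - 1))) ∨
  (d / (β - 1) < p ∧ max (max p (p / (p - 1))) (d / (α - 1)) < r)

/-- With `σ = 2 − (1/α)(d/r+1) − (d/β)(1/p−1/r) − 1/β` and
`p₂ = drα/(β(r(α−1)−d) + dα)` one has `1 < p₂ < r` and `σ + (d/β)(1/p₂ − 1/r) < 1`. -/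
theorem p2_range
    (d : ℕ) (hd : 2 ≤ d) (α β p r σ p₂ : ℝ)
    (hα : α ∈ Set.Ioc (1:ℝ) 2) (hβ : β ∈ Set.Ioc (1:ℝ) (d:ℝ))
    (hpr : H2strict (d:ℝ) α β p r)
    (hextra : 0 ≤ 2 * β * (α - 1) - α → p < (d:ℝ) * α / (2 * β * (α - 1) - α))
    (hσ : σ = 2 - (1/α) * ((d:ℝ)/r + 1) - ((d:ℝ)/β) * (1/p - 1/r) - 1/β)
    (hp₂ : p₂ = (d:ℝ) * r * α / (β * (r * (α - 1) - (d:ℝ)) + (d:ℝ) * α)) :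
    1 < p₂ ∧ p₂ < r ∧ σ + ((d:ℝ)/β) * (1/p₂ - 1/r) < 1 := by
  obtain ⟨hα1, hα2⟩ := hα
  obtain ⟨hβ1, hβd⟩ := hβ
  have hd2 : (2:ℝ) ≤ (d:ℝ) := by exact_mod_cast hd
  clear hd
  generalize (d:ℝ) = D at *
  have hD : 0 < D := by linarith
  have hp : 0 < p := by
    rcases hpr with ⟨h, -⟩ | ⟨h, -⟩
    · have h1 : 0 < 2 * D / (D + β - 1) := div_pos (by linarith) (by linarith)
      exact h1.trans ((le_max_left _ _).trans_lt h)
    · have h1 : 0 < D / (β - 1) := div_pos hD (by linarith)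
      exact h1.trans h
  have hr1 : D / (α - 1) < r := by
    rcases hpr with ⟨-, -, h, -⟩ | ⟨-, h⟩
    · exact (le_max_right _ _).trans_lt h
    · exact (le_max_right _ _).trans_lt h
  have hα0 : 0 < α - 1 := by linarith
  have hr : 0 < r := (div_pos hD hα0).trans hr1
  have hrd : D < r * (α - 1) := (div_lt_iff₀ hα0).1 hr1
  have hDα : 0 < D * α := by positivity
  have hE : (2 * β * (α - 1) - α) * p < D * α := by
    rcases lt_trichotomy (2 * β * (α - 1) - α) 0 with h | h | h
    · nlinarith [mul_pos_of_neg_of_neg h (neg_lt_zero.2 hp)]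
    · rw [h]; linarith
    · have := (lt_div_iff₀ h).1 (hextra h.le)
      linarith
  have hN : 0 < β * (r * (α - 1) - D) := mul_pos (by linarith) (by linarith)
  have hαp : 0 < α := by linarith
  have hβp : 0 < β := by linarith
  have hden : 0 < β * (r * (α - 1) - D) + D * α := by linarith
  refine ⟨?_, ?_, ?_⟩
  · rw [hp₂, lt_div_iff₀ hden]
    rcases le_total α β with h | h
    · nlinarith [mul_nonneg (sub_nonneg.2 h) hD.le, mul_nonneg (sub_nonneg.2 hβd) (mul_pos hr hα0).le, mul_pos hD hr]
    · nlinarith [mul_nonneg (sub_nonneg.2 h) (sub_nonneg.2 hrd.le), mul_pos hr hαp, mul_pos (mul_pos hr hαp) (show 0 < D - (α - 1) by linarith)]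
  · rw [hp₂, div_lt_iff₀ hden]
    nlinarith [mul_pos hr hN]
  · have e : σ + (D/β) * (1/p₂ - 1/r) - 1 =
        ((2 * β * (α - 1) - α) * p - D * α) / (α * β * p) + (D / r) * ((α - 2 * β) / (α * β)) := by
      rw [hσ, hp₂]
      field_simp
      ring
    have h1 : ((2 * β * (α - 1) - α) * p - D * α) / (α * β * p) < 0 :=
      div_neg_of_neg_of_pos (by linarith) (by positivity)
    have h2 : (D / r) * ((α - 2 * β) / (α * β)) < 0 :=
      mul_neg_of_pos_of_neg (by positivity) (div_neg_of_neg_of_pos (by linarith) (by positivity))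
    linarith
end

section
/- Let d ≥ 1, α ∈ (0,2], let u : ℝ^d → ℝ be a Schwartz function, and write u₋(x) = max{−u(x), 0} and u₊(x) = max{u(x), 0}. Then for every x ∈ ℝ^d and every ε > 0, the truncated integrals below converge absolutely and satisfy: −u₋(x) · ∫_{|x−y| ≥ ε} (u(x) − u(y)) / |x−y|^{d+α} dy ≥ u₋(x) · ∫_{|x−y| ≥ ε} (u₋(x) − u₋(y)) / |x−y|^{d+α} dy, and likewise u₊(x) · ∫_{|x−y| ≥ ε} (u(x) − u(y)) / |x−y|^{d+α} dy ≥ u₊(x) · ∫_{|x−y| ≥ ε} (u₊(x) − u₊(y)) / |x−y|^{d+α} dy. -/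
open MeasureTheory

/-- Difference of positive parts of bounded numbers. -/
theorem trunc_max_aux (a b M : ℝ) (ha : |a| ≤ M) (hb : |b| ≤ M) :
    |max a 0 - max b 0| ≤ 2 * M := by
  have h0 : 0 ≤ M := (abs_nonneg _).trans ha
  have h1 : max a 0 ≤ M := max_le ((le_abs_self a).trans ha) h0
  have h2 : max b 0 ≤ M := max_le ((le_abs_self b).trans hb) h0
  have h3 := le_max_right a 0
  have h4 := le_max_right b 0
  rw [abs_le]
  constructor <;> linarith

/-- A bounded continuous function divided by `‖x - y‖ ^ r`, `r > d`, is integrable off a ball. -/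
theorem trunc_integrable_aux (d : ℕ) (r : ℝ) (hr : (d:ℝ) < r)
    (x : EuclideanSpace ℝ (Fin d)) (ε : ℝ) (hε : 0 < ε)
    (f : EuclideanSpace ℝ (Fin d) → ℝ) (hf : Continuous f) (C : ℝ) (hC : ∀ y, |f y| ≤ C) :
    IntegrableOn (fun y => f y / ‖x - y‖ ^ r) {y | ε ≤ ‖x - y‖} volume := by
  have h1 : Integrable (fun z : EuclideanSpace ℝ (Fin d) => (1 + ‖z‖) ^ (-r)) volume :=
    integrable_one_add_norm (by simpa using hr)
  have h2 : Integrable (fun y : EuclideanSpace ℝ (Fin d) => (1 + ‖x - y‖) ^ (-r)) volume :=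
    h1.comp_sub_left x
  have h3 := (h2.const_mul (C * (1 + 1 / ε) ^ r)).integrableOn (s := {y | ε ≤ ‖x - y‖})
  have hS : MeasurableSet {y : EuclideanSpace ℝ (Fin d) | ε ≤ ‖x - y‖} :=
    (isClosed_le continuous_const (by fun_prop)).measurableSet
  have hr0 : 0 < r := lt_of_le_of_lt (Nat.cast_nonneg d) hr
  refine Integrable.mono' h3 ?_ ?_
  · have hm : Measurable (fun y => f y / ‖x - y‖ ^ r) := by
      have := hf.measurable
      fun_prop
    exact hm.aestronglyMeasurable
  · refine (ae_restrict_iff' hS).2 (Filter.Eventually.of_forall fun y hy => ?_)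
    have hy' : ε ≤ ‖x - y‖ := hy
    have hp : 0 < ‖x - y‖ := hε.trans_le hy'
    have hle : 1 + ‖x - y‖ ≤ (1 + 1 / ε) * ‖x - y‖ := by
      have : 1 ≤ ‖x - y‖ / ε := (one_le_div hε).2 hy'
      have e : (1 + 1 / ε) * ‖x - y‖ = ‖x - y‖ + ‖x - y‖ / ε := by ring
      linarith
    have hpow : (1 + ‖x - y‖) ^ r ≤ (1 + 1 / ε) ^ r * ‖x - y‖ ^ r := by
      rw [← Real.mul_rpow (by positivity) (by positivity)]
      exact Real.rpow_le_rpow (by positivity) hle hr0.le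
    have hq : 0 < ‖x - y‖ ^ r := Real.rpow_pos_of_pos hp r
    have hq1 : 0 < (1 + ‖x - y‖) ^ r := Real.rpow_pos_of_pos (by positivity) r
    have hC0 : 0 ≤ C := (abs_nonneg _).trans (hC y)
    rw [Real.norm_eq_abs, abs_div, abs_of_pos hq, Real.rpow_neg (by positivity), ← div_eq_mul_inv,
      div_le_div_iff₀ hq hq1, mul_assoc]
    exact mul_le_mul (hC y) hpow hq1.le hC0

/-- For a Schwartz function `u` with negative part `u₋ = max{−u, 0}` and positive part
`u₊ = max{u, 0}`, the truncated singular integrals defining the fractional Laplacian converge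
absolutely and satisfy the pointwise Córdoba-type inequalities
`−u₋(x) ∫_{|x−y|≥ε} (u(x)−u(y))/|x−y|^{d+α} dy ≥ u₋(x) ∫_{|x−y|≥ε} (u₋(x)−u₋(y))/|x−y|^{d+α} dy`
and the analogous inequality for `u₊`. -/
theorem truncated_fracLap_sign_inequalities
    (d : ℕ) (hd : 1 ≤ d) (α : ℝ) (hα : α ∈ Set.Ioc (0:ℝ) 2)
    (u : SchwartzMap (EuclideanSpace ℝ (Fin d)) ℝ)
    (x : EuclideanSpace ℝ (Fin d)) (ε : ℝ) (hε : 0 < ε) :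
    IntegrableOn (fun y => (u x - u y) / ‖x - y‖ ^ ((d:ℝ) + α))
      {y | ε ≤ ‖x - y‖} volume ∧
    IntegrableOn (fun y => (max (-(u x)) 0 - max (-(u y)) 0) / ‖x - y‖ ^ ((d:ℝ) + α))
      {y | ε ≤ ‖x - y‖} volume ∧
    IntegrableOn (fun y => (max (u x) 0 - max (u y) 0) / ‖x - y‖ ^ ((d:ℝ) + α))
      {y | ε ≤ ‖x - y‖} volume ∧
    -(max (-(u x)) 0) * (∫ y in {y | ε ≤ ‖x - y‖}, (u x - u y) / ‖x - y‖ ^ ((d:ℝ) + α)) ≥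
      max (-(u x)) 0 *
        ∫ y in {y | ε ≤ ‖x - y‖},
          (max (-(u x)) 0 - max (-(u y)) 0) / ‖x - y‖ ^ ((d:ℝ) + α) ∧
    max (u x) 0 * (∫ y in {y | ε ≤ ‖x - y‖}, (u x - u y) / ‖x - y‖ ^ ((d:ℝ) + α)) ≥
      max (u x) 0 *
        ∫ y in {y | ε ≤ ‖x - y‖},
          (max (u x) 0 - max (u y) 0) / ‖x - y‖ ^ ((d:ℝ) + α) := by
  have hr : (d:ℝ) < (d:ℝ) + α := by linarith [hα.1]
  obtain ⟨M, hM⟩ : ∃ M : ℝ, ∀ y, |u y| ≤ M :=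
    ⟨_, fun y => SchwartzMap.norm_le_seminorm ℝ u y⟩
  have hu : Continuous u := u.continuous
  have hb := fun y => abs_le.1 (hM y)
  have i1 := trunc_integrable_aux d _ hr x ε hε (fun y => u x - u y) (by fun_prop) (2 * M)
    (fun y => by have := hb x; have := hb y; rw [abs_le]; constructor <;> linarith)
  have i2 := trunc_integrable_aux d _ hr x ε hε (fun y => max (-(u x)) 0 - max (-(u y)) 0)
    (by fun_prop) (2 * M)
    (fun y => trunc_max_aux _ _ _ (by rw [abs_neg]; exact hM x) (by rw [abs_neg]; exact hM y))
  have i3 := trunc_integrable_aux d _ hr x ε hε (fun y => max (u x) 0 - max (u y) 0)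
    (by fun_prop) (2 * M)
    (fun y => trunc_max_aux _ _ _ (hM x) (hM y))
  refine ⟨i1, i2, i3, ?_, ?_⟩
  · rw [ge_iff_le, ← integral_const_mul, ← integral_const_mul]
    refine integral_mono (i2.const_mul _) (i1.const_mul _) fun y => ?_
    simp only [← mul_div_assoc]
    refine div_le_div_of_nonneg_right ?_ (by positivity)
    rcases le_total 0 (u x) with h | h
    · simp [h]
    · rw [neg_mul, ← mul_neg]
      refine mul_le_mul_of_nonneg_left ?_ (le_max_right _ _)
      rw [max_eq_left (by linarith : 0 ≤ -(u x))]
      linarith [le_max_left (-(u y)) 0]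
  · rw [ge_iff_le, ← integral_const_mul, ← integral_const_mul]
    refine integral_mono (i3.const_mul _) (i1.const_mul _) fun y => ?_
    simp only [← mul_div_assoc]
    refine div_le_div_of_nonneg_right ?_ (by positivity)
    rcases le_total (u x) 0 with h | h
    · simp [h]
    · refine mul_le_mul_of_nonneg_left ?_ (le_max_right _ _)
      rw [max_eq_left h]
      linarith [le_max_left (u y) 0]
end

section
/- Let d ≥ 1, α ∈ (0,2], 1 < p < ∞, let u : ℝ^d → ℝ be a Schwartz function, and let ε > 0. Then the double integral is absolutely convergent and nonnegative: ∫_{ℝ^d} |u(x)|^{p−2} u(x) · ( ∫_{|x−y| ≥ ε} (u(x) − u(y)) / |x−y|^{d+α} dy ) dx ≥ 0. -/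
open MeasureTheory

lemma aux_mono (p : ℝ) (hp : 1 < p) (s t : ℝ) :
    0 ≤ (|s| ^ (p - 2) * s - |t| ^ (p - 2) * t) * (s - t) := by
  have key : ∀ a : ℝ, 0 ≤ a → a ^ (p - 2) * a = a ^ (p - 1) := by
    intro a ha
    rcases ha.eq_or_lt with rfl | h
    · rw [mul_zero, Real.zero_rpow (by linarith)]
    · nth_rewrite 2 [← Real.rpow_one a]
      rw [← Real.rpow_add h]; congr 1; ring
  have hs := abs_nonneg s
  have ht := abs_nonneg t
  have hA : 0 ≤ |s| ^ (p - 2) := Real.rpow_nonneg hs _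
  have hB : 0 ≤ |t| ^ (p - 2) := Real.rpow_nonneg ht _
  have h1 : 0 ≤ (|s| ^ (p - 2) * |s| - |t| ^ (p - 2) * |t|) * (|s| - |t|) := by
    rw [key _ hs, key _ ht]
    rcases le_total (|s|) (|t|) with h | h
    · have := Real.rpow_le_rpow hs h (by linarith : 0 ≤ p - 1)
      exact mul_nonneg_of_nonpos_of_nonpos (by linarith) (by linarith)
    · have := Real.rpow_le_rpow ht h (by linarith : 0 ≤ p - 1)
      exact mul_nonneg (by linarith) (by linarith)
  have h2 : s * t ≤ |s| * |t| := by rw [← abs_mul]; exact le_abs_self _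
  have h3 := mul_le_mul_of_nonneg_left h2 (add_nonneg hA hB)
  have h4 := abs_mul_abs_self s
  have h5 := abs_mul_abs_self t
  generalize |s| ^ (p - 2) = A at *
  generalize |t| ^ (p - 2) = B at *
  have : (A * s - B * t) * (s - t) = A * (s * s) + B * (t * t) - (A + B) * (s * t) := by ring
  rw [this, ← h4, ← h5]
  nlinarith

lemma aux_abs (p : ℝ) (hp : 1 < p) (s : ℝ) : ‖|s| ^ (p - 2) * s‖ = ‖s‖ ^ (p - 1) := by
  rw [norm_mul, Real.norm_eq_abs, Real.norm_eq_abs, abs_of_nonneg (Real.rpow_nonneg (abs_nonneg s) _)]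
  rcases (abs_nonneg s).eq_or_lt with h | h
  · rw [← h, mul_zero, Real.zero_rpow (by linarith)]
  · nth_rewrite 2 [← Real.rpow_one (|s|)]
    rw [← Real.rpow_add h]; congr 1; ring

lemma aux_ker (d : ℕ) (α : ℝ) (hα : 0 < α) (ε : ℝ) (hε : 0 < ε) :
    Integrable (fun z : EuclideanSpace ℝ (Fin d) =>
      ({z | ε ≤ ‖z‖} : Set (EuclideanSpace ℝ (Fin d))).indicator
        (fun z => (‖z‖ ^ ((d:ℝ) + α))⁻¹) z) := by
  have hr : 0 < (d:ℝ) + α := by positivity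
  have h1 : Integrable (fun z : EuclideanSpace ℝ (Fin d) => (1 + ‖z‖) ^ (-((d:ℝ) + α))) :=
    integrable_one_add_norm (by simpa using hα)
  have hm : MeasurableSet ({z | ε ≤ ‖z‖} : Set (EuclideanSpace ℝ (Fin d))) :=
    measurableSet_le measurable_const measurable_norm
  refine (h1.const_mul ((1/ε + 1) ^ ((d:ℝ) + α))).mono' ?_ (Filter.Eventually.of_forall ?_)
  · refine (Measurable.indicator ?_ hm).aestronglyMeasurable
    fun_prop
  · intro z
    by_cases hz : ε ≤ ‖z‖
    · rw [Set.indicator_of_mem (by exact hz)]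
      have hz0 : 0 < ‖z‖ := hε.trans_le hz
      rw [Real.norm_of_nonneg (by positivity), Real.rpow_neg (by positivity),
        ← div_eq_mul_inv, le_div_iff₀ (by positivity), inv_mul_le_iff₀ (by positivity),
        ← Real.mul_rpow (by positivity) (by positivity)]
      apply Real.rpow_le_rpow (by positivity) _ hr.le
      have : 1 ≤ ‖z‖ / ε := by rwa [le_div_iff₀ hε, one_mul]
      have e : ‖z‖ * (1/ε + 1) = ‖z‖/ε + ‖z‖ := by ring
      linarith
    · rw [Set.indicator_of_notMem (by exact hz)]
      simp only [norm_zero]; positivity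

theorem truncated_fracLap_positivity
    (d : ℕ) (hd : 1 ≤ d) (α : ℝ) (hα : α ∈ Set.Ioc (0:ℝ) 2)
    (p : ℝ) (hp : 1 < p)
    (u : SchwartzMap (EuclideanSpace ℝ (Fin d)) ℝ) (ε : ℝ) (hε : 0 < ε) :
    (∀ x, IntegrableOn (fun y => (u x - u y) / ‖x - y‖ ^ ((d:ℝ) + α))
      {y | ε ≤ ‖x - y‖} volume) ∧
    Integrable (fun x => |u x| ^ (p - 2) * u x *
      ∫ y in {y | ε ≤ ‖x - y‖}, (u x - u y) / ‖x - y‖ ^ ((d:ℝ) + α)) ∧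
    0 ≤ ∫ x, |u x| ^ (p - 2) * u x *
      ∫ y in {y | ε ≤ ‖x - y‖}, (u x - u y) / ‖x - y‖ ^ ((d:ℝ) + α) := by
  set k : EuclideanSpace ℝ (Fin d) → ℝ := fun z =>
      ({z | ε ≤ ‖z‖} : Set (EuclideanSpace ℝ (Fin d))).indicator
        (fun z => (‖z‖ ^ ((d:ℝ) + α))⁻¹) z with hk
  have hki : Integrable k := aux_ker d α hα.1 ε hε
  have hk0 : ∀ z, 0 ≤ k z := fun z => Set.indicator_nonneg (fun z _ => by positivity) z
  have hke : ∀ x y, k (x - y) = k (y - x) := by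
    intro x y
    simp only [hk, Set.indicator, Set.mem_setOf_eq, norm_sub_rev x y]
  have hm : ∀ x : EuclideanSpace ℝ (Fin d), MeasurableSet {y | ε ≤ ‖x - y‖} := fun x =>
    measurableSet_le measurable_const (by fun_prop)
  have hind : ∀ x : EuclideanSpace ℝ (Fin d), (({y | ε ≤ ‖x - y‖} : Set (EuclideanSpace ℝ (Fin d))).indicator
      (fun y => (u x - u y) / ‖x - y‖ ^ ((d:ℝ) + α))) = fun y => (u x - u y) * k (x - y) := by
    intro x; ext y
    by_cases h : ε ≤ ‖x - y‖ <;> simp [hk, Set.indicator, h, div_eq_mul_inv]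
  obtain ⟨C, hC⟩ : ∃ C, ∀ x, |u x| ≤ C := by
    refine ⟨_, fun x => SchwartzMap.norm_le_seminorm ℝ u x⟩
  have hCd : ∀ x y, ‖u x - u y‖ ≤ 2 * C := by
    intro x y
    have h1 := hC x
    have h2 := hC y
    rw [Real.norm_eq_abs]
    have := abs_sub (u x) (u y)
    linarith
  have huc : Continuous u := u.continuous
  set g : EuclideanSpace ℝ (Fin d) → ℝ := fun x => |u x| ^ (p - 2) * u x with hg
  have hgm : Measurable g := by
    have := huc.measurable
    have h2 : Measurable fun x => |u x| := huc.abs.measurable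
    exact (h2.pow_const _).mul this
  have hgi : Integrable g := by
    have h := (u.memLp (ENNReal.ofReal (p - 1)) volume).integrable_norm_rpow
      (by simpa using hp) ENNReal.ofReal_ne_top
    rw [ENNReal.toReal_ofReal (by linarith)] at h
    refine h.mono' hgm.aestronglyMeasurable (Filter.Eventually.of_forall fun x => ?_)
    exact (aux_abs p hp (u x)).le
  have hF : Integrable (fun q : EuclideanSpace ℝ (Fin d) × EuclideanSpace ℝ (Fin d) =>
      g q.1 * ((u q.1 - u q.2) * k (q.1 - q.2))) (volume.prod volume) := by
    have h0 := (Integrable.convolution_integrand (ContinuousLinearMap.mul ℝ ℝ) hgi hki).swap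
    have h1 : Integrable (fun q : EuclideanSpace ℝ (Fin d) × EuclideanSpace ℝ (Fin d) =>
      g q.1 * k (q.1 - q.2)) (volume.prod volume) := by
      refine h0.congr (Filter.Eventually.of_forall fun q => ?_)
      simp [hke q.1 q.2]
    have h2 := h1.bdd_mul (c := 2 * C) (f := fun q => u q.1 - u q.2)
      (by fun_prop) (Filter.Eventually.of_forall fun q => hCd _ _)
    refine h2.congr (Filter.Eventually.of_forall fun q => ?_)
    simp only []; ring
  have hin : ∀ x, g x * ∫ y in {y | ε ≤ ‖x - y‖}, (u x - u y) / ‖x - y‖ ^ ((d:ℝ) + α)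
      = ∫ y, g x * ((u x - u y) * k (x - y)) := by
    intro x
    rw [← integral_indicator (hm x), hind, integral_const_mul]
  refine ⟨fun x => ?_, ?_, ?_⟩
  · rw [← integrable_indicator_iff (hm x), hind]
    exact (hki.comp_sub_left x).bdd_mul (c := 2 * C) (by fun_prop)
      (Filter.Eventually.of_forall fun q => hCd _ _)
  · have := hF.integral_prod_left
    refine this.congr (Filter.Eventually.of_forall fun x => ?_)
    exact (hin x).symm
  · have e : (∫ x, g x * ∫ y in {y | ε ≤ ‖x - y‖}, (u x - u y) / ‖x - y‖ ^ ((d:ℝ) + α))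
      = ∫ q, g q.1 * ((u q.1 - u q.2) * k (q.1 - q.2)) ∂(volume.prod volume) := by
      rw [integral_prod _ hF]
      exact integral_congr_ae (Filter.Eventually.of_forall fun x => hin x)
    rw [e]
    have e2 := integral_prod_swap (μ := volume) (ν := volume)
      (fun q : EuclideanSpace ℝ (Fin d) × EuclideanSpace ℝ (Fin d) =>
      g q.1 * ((u q.1 - u q.2) * k (q.1 - q.2)))
    have e3 := integral_add hF hF.swap
    have e4 : 0 ≤ ∫ q : EuclideanSpace ℝ (Fin d) × EuclideanSpace ℝ (Fin d), (g q.1 * ((u q.1 - u q.2) * k (q.1 - q.2)) + ((fun q : EuclideanSpace ℝ (Fin d) × EuclideanSpace ℝ (Fin d) =>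
      g q.1 * ((u q.1 - u q.2) * k (q.1 - q.2))) ∘ Prod.swap) q) ∂(volume.prod volume) := by
      apply integral_nonneg
      intro q
      have h := mul_nonneg (aux_mono p hp (u q.1) (u q.2)) (hk0 (q.1 - q.2))
      simp only [Function.comp, Prod.fst_swap, Prod.snd_swap, Pi.zero_apply, hke q.2 q.1]
      simp only [hg]
      linarith
    rw [e3] at e4
    simp only [Function.comp] at e4 
    linarith
end
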